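/- For every multicomplex M contained in S_d(X, (∞, a)), there exists a (0)-compressed multicomplex M' ⊆ S_d(X, (∞, a)) with the same F-vector as M. -/

import Mathlib

open Finset

variable {X : Type*} [Fintype X] [LinearOrder X]

/-- Total degree of a monomial (exponent vector). -/
def degM (μ : X →₀ ℕ) : ℕ := ∑ x, μ x

/-- Degree of the part of a monomial supported in the variables of color `i`. -/
def degC (c : X → ℕ) (i : ℕ) (μ : X →₀ ℕ) : ℕ :=
  ∑ x ∈ Finset.univ.filter (fun x => c x = i), μ x

/-- Membership in `S_d(X,(∞,a))`: total degree at most `d` and, for `1 ≤ i ≤ m`, the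
`X_i`-part has degree at most `a i` (color `0` is `X₀`, unconstrained). -/
def InS (c : X → ℕ) (a : ℕ → ℕ) (m d : ℕ) (μ : X →₀ ℕ) : Prop :=
  degM μ ≤ d ∧ ∀ i, 1 ≤ i → i ≤ m → degC c i μ ≤ a i

/-- Revlex comparison of the parts of two monomials supported on `{x | P x}` (the order `≻`
on variables is `>`; at the `≻`-least variable of `P` where they differ, `μ` is smaller). -/
def MonRevGTOn (P : X → Prop) (μ ν : X →₀ ℕ) : Prop :=
  ∃ x, P x ∧ μ x < ν x ∧ ∀ y, P y → y < x → μ y = ν y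

/-- A multicomplex: a set of monomials closed under divisibility. -/
def DivClosed (M : Finset (X →₀ ℕ)) : Prop :=
  ∀ μ ∈ M, ∀ ν : X →₀ ℕ, (∀ x, ν x ≤ μ x) → ν ∈ M

/-- The F-vector of a finite multicomplex. -/
def FVec (M : Finset (X →₀ ℕ)) (j : ℕ) : ℕ := (M.filter (fun μ => degM μ = j)).card

/-- `M` is `(0,i)`-compressed: together with `μ` it contains every monomial `μ'` of `S`
of the same degree agreeing with `μ` outside `X₀ ∪ X_i` whose `(X₀ ∪ X_i)`-part is
revlex-larger. -/
def Compressed0i (c : X → ℕ) (a : ℕ → ℕ) (m d i : ℕ) (M : Finset (X →₀ ℕ)) : Prop :=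
  ∀ μ ∈ M, ∀ μ' : X →₀ ℕ, InS c a m d μ' → degM μ' = degM μ →
    (∀ x, c x ≠ 0 → c x ≠ i → μ' x = μ x) →
    MonRevGTOn (fun x => c x = 0 ∨ c x = i) μ' μ → μ' ∈ M

set_option linter.unusedSimpArgs false
set_option linter.unusedSectionVars false

/-- Partial degree over a finset of variables. -/
def degW (W : Finset X) (μ : X →₀ ℕ) : ℕ := ∑ x ∈ W, μ x

lemma degM_add (μ ν : X →₀ ℕ) : degM (μ + ν) = degM μ + degM ν := by
  simp [degM, Finset.sum_add_distrib]

lemma degM_single (x : X) (n : ℕ) : degM (Finsupp.single x n) = n := by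
  simp [degM, Finsupp.single_apply]

lemma degW_add (W : Finset X) (μ ν : X →₀ ℕ) : degW W (μ + ν) = degW W μ + degW W ν := by
  simp [degW, Finset.sum_add_distrib]

lemma degW_single (W : Finset X) (x : X) (n : ℕ) :
    degW W (Finsupp.single x n) = if x ∈ W then n else 0 := by
  simp [degW, Finsupp.single_apply]

lemma degM_mono {μ ν : X →₀ ℕ} (h : μ ≤ ν) : degM μ ≤ degM ν :=
  Finset.sum_le_sum fun x _ => h x

lemma degW_mono (W : Finset X) {μ ν : X →₀ ℕ} (h : μ ≤ ν) : degW W μ ≤ degW W ν :=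
  Finset.sum_le_sum fun x _ => h x

lemma degW_le_degM (W : Finset X) (μ : X →₀ ℕ) : degW W μ ≤ degM μ :=
  Finset.sum_le_sum_of_subset (Finset.subset_univ _)

lemma degW_eq_degM (W : Finset X) (μ : X →₀ ℕ) (h : ∀ x, x ∉ W → μ x = 0) :
    degW W μ = degM μ :=
  Finset.sum_subset (Finset.subset_univ _) fun x _ hx => h x hx

/-- The lex comparison. -/
lemma lex_iff (μ ν : X →₀ ℕ) :
    toLex μ < toLex ν ↔ ∃ x, (∀ y, y < x → μ y = ν y) ∧ μ x < ν x := by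
  rw [Finsupp.Lex.lt_iff]
  rfl

lemma lex_add {μ ν : X →₀ ℕ} (h : toLex μ < toLex ν) (σ : X →₀ ℕ) :
    toLex (μ + σ) < toLex (ν + σ) := by
  rw [lex_iff] at *
  obtain ⟨x, h1, h2⟩ := h
  exact ⟨x, fun y hy => by simp [h1 y hy], by simpa using h2⟩

lemma lex_of_add {μ ν σ : X →₀ ℕ} (h : toLex (μ + σ) < toLex (ν + σ)) :
    toLex μ < toLex ν := by
  rw [lex_iff] at *
  obtain ⟨x, h1, h2⟩ := h
  exact ⟨x, fun y hy => by simpa using h1 y hy, by simpa using h2⟩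

/-- Equal degree and agreement off one variable force equality. -/
lemma eq_of_degM {μ ν : X →₀ ℕ} (y : X) (hd : degM μ = degM ν)
    (h : ∀ z, z ≠ y → μ z = ν z) : μ = ν := by
  ext z
  by_cases hz : z = y
  · subst hz
    unfold degM at hd
    rw [← Finset.add_sum_erase _ _ (Finset.mem_univ z),
      ← Finset.add_sum_erase (a := z) _ (⇑ν) (Finset.mem_univ z)] at hd
    have : ∑ x ∈ Finset.univ.erase z, μ x = ∑ x ∈ Finset.univ.erase z, ν x :=
      Finset.sum_congr rfl fun x hx => h x (Finset.ne_of_mem_erase hx)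
    omega
  · exact h z hz

lemma divClosed_of_step {M : Finset (X →₀ ℕ)}
    (h : ∀ σ : X →₀ ℕ, ∀ x, σ + Finsupp.single x 1 ∈ M → σ ∈ M) : DivClosed M := by
  intro μ hμ ν hν
  have hle : ν ≤ μ := hν
  obtain ⟨δ, rfl⟩ := exists_add_of_le hle
  clear hν hle
  induction hn : degM δ generalizing δ with
  | zero =>
    have : δ = 0 := by
      ext x
      have : δ x ≤ degM δ := Finset.single_le_sum (f := δ) (fun _ _ => Nat.zero_le _) (Finset.mem_univ x)
      simp; omega
    simpa [this] using hμ
  | succ n ih =>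
    have : ∃ x, δ x ≠ 0 := by
      by_contra hcon
      push Not at hcon
      have : degM δ = 0 := Finset.sum_eq_zero fun x _ => hcon x
      omega
    obtain ⟨x, hx⟩ := this
    have hle : Finsupp.single x 1 ≤ δ := by
      rw [Finsupp.single_le_iff]; omega
    obtain ⟨ε, rfl⟩ := exists_add_of_le hle
    rw [degM_add, degM_single] at hn
    refine ih ε (h _ x ?_) (by omega)
    convert hμ using 1
    abel

lemma DivClosed.step {M : Finset (X →₀ ℕ)} (hM : DivClosed M) {σ δ : X →₀ ℕ}
    (h : σ + δ ∈ M) : σ ∈ M := hM _ h _ fun x => by simp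

/-- Lower sets for lex inside each class of `key`. -/
def Lower {κ : Type*} (key : (X →₀ ℕ) → κ) (T : Set (X →₀ ℕ)) (M : Finset (X →₀ ℕ)) : Prop :=
  ∀ μ ∈ M, ∀ μ' ∈ T, key μ' = key μ → toLex μ' < toLex μ → μ' ∈ M

/-- Compression along the classes of `key` preserves multicomplexes. -/
def Good {κ : Type*} [DecidableEq κ] (key : (X →₀ ℕ) → κ) (T : Set (X →₀ ℕ)) : Prop :=
  ∀ M N : Finset (X →₀ ℕ), (∀ μ ∈ M, μ ∈ T) → (∀ μ ∈ N, μ ∈ T) → DivClosed M →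
    (∀ k, (N.filter (fun μ => key μ = k)).card = (M.filter (fun μ => key μ = k)).card) →
    Lower key T N → DivClosed N

lemma exists_lower {κ : Type*} [DecidableEq κ] (key : (X →₀ ℕ) → κ) (T : Set (X →₀ ℕ))
    (rk : (X →₀ ℕ) → ℕ) (hrk : ∀ μ ∈ T, ∀ ν ∈ T, toLex μ < toLex ν → rk μ < rk ν)
    (M : Finset (X →₀ ℕ)) (hM : ∀ μ ∈ M, μ ∈ T) :
    ∃ M' : Finset (X →₀ ℕ), (∀ μ ∈ M', μ ∈ T) ∧
      (∀ k, (M'.filter (fun μ => key μ = k)).card = (M.filter (fun μ => key μ = k)).card) ∧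
      Lower key T M' ∧ (∑ μ ∈ M, rk μ ≤ ∑ μ ∈ M', rk μ → Lower key T M) := by
  let Q : Finset (X →₀ ℕ) → Prop := fun M' => (∀ μ ∈ M', μ ∈ T) ∧
      (∀ k, (M'.filter (fun μ => key μ = k)).card = (M.filter (fun μ => key μ = k)).card)
  have hQM : Q M := ⟨hM, fun _ => rfl⟩
  have key1 : ∀ A, Q A → (∀ B, Q B → ∑ μ ∈ A, rk μ ≤ ∑ μ ∈ B, rk μ) → Lower key T A := by
    intro A hA hmin μ hμ μ' hμ' hk hlt
    by_contra hn
    have hr := hrk μ' hμ' μ (hA.1 μ hμ) hlt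
    have hn' : μ' ∉ A.erase μ := fun h => hn (Finset.mem_of_mem_erase h)
    have := hmin (insert μ' (A.erase μ)) ⟨?_, ?_⟩
    · rw [Finset.sum_insert hn', ← Finset.add_sum_erase _ _ hμ] at this
      omega
    · intro ν hν
      rcases Finset.mem_insert.1 hν with rfl | h
      · exact hμ'
      · exact hA.1 _ (Finset.mem_of_mem_erase h)
    · intro k
      rw [← hA.2 k, Finset.filter_insert, Finset.filter_erase]
      split_ifs with h
      · have h2 : μ ∈ A.filter (fun μ => key μ = k) := by
          simp [hμ, ← hk, h]
        rw [Finset.card_insert_of_notMem, Finset.card_erase_add_one h2]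
        intro h3
        exact hn (Finset.mem_filter.1 (Finset.mem_of_mem_erase h3)).1
      · rw [Finset.erase_eq_of_notMem]
        intro h3
        exact h (hk.trans (Finset.mem_filter.1 h3).2)
  obtain ⟨A, hA, hmin⟩ : ∃ A, Q A ∧ ∀ B, Q B → ∑ μ ∈ A, rk μ ≤ ∑ μ ∈ B, rk μ := by
    obtain ⟨A, hA⟩ := exists_minimalFor_of_wellFoundedLT Q (fun A => ∑ μ ∈ A, rk μ) ⟨M, hQM⟩
    refine ⟨A, hA.1, fun B hB => ?_⟩
    rcases le_total (∑ μ ∈ A, rk μ) (∑ μ ∈ B, rk μ) with h | h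
    · exact h
    · exact hA.2 hB h
  exact ⟨A, hA.1, hA.2, key1 A hA hmin, fun h => key1 M hQM fun B hB => h.trans (hmin B hB)⟩

lemma exists_rank (T : Set (X →₀ ℕ)) (hT : T.Finite) :
    ∃ rk : (X →₀ ℕ) → ℕ, ∀ μ ∈ T, ∀ ν ∈ T, toLex μ < toLex ν → rk μ < rk ν := by
  classical
  refine ⟨fun μ => (hT.toFinset.filter (fun ν => toLex ν < toLex μ)).card, ?_⟩
  intro μ hμ ν hν h
  apply Finset.card_lt_card
  rw [Finset.ssubset_iff_of_subset]
  · exact ⟨μ, by simp [hμ, h], by simp⟩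
  · intro σ hσ
    simp only [Finset.mem_filter] at *
    exact ⟨hσ.1, hσ.2.trans h⟩

/-- The key of a `P`-compression. -/
def keyP (P : Finset X) (μ : X →₀ ℕ) : (X →₀ ℕ) × ℕ := (μ.filter (fun x => x ∉ P), degM μ)

lemma keyP_eq {P : Finset X} {μ ν : X →₀ ℕ} :
    keyP P μ = keyP P ν ↔ (∀ x, x ∉ P → μ x = ν x) ∧ degM μ = degM ν := by
  unfold keyP
  rw [Prod.mk.injEq, Finsupp.ext_iff]
  refine and_congr_left fun _ => forall_congr' fun x => ?_
  by_cases h : x ∈ P <;> simp [h]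

lemma fvec_of_keyP {P : Finset X} {M N : Finset (X →₀ ℕ)}
    (h : ∀ k, (N.filter (fun μ => keyP P μ = k)).card = (M.filter (fun μ => keyP P μ = k)).card)
    (j : ℕ) : FVec N j = FVec M j := by
  have aux : ∀ A : Finset (X →₀ ℕ), A ⊆ M ∪ N → FVec A j =
      ∑ k ∈ (M ∪ N).image (keyP P), if k.2 = j then (A.filter (fun μ => keyP P μ = k)).card else 0 := by
    intro A hA
    unfold FVec
    rw [Finset.card_eq_sum_card_fiberwise (f := keyP P) (t := (M ∪ N).image (keyP P))]
    · refine Finset.sum_congr rfl fun k _ => ?_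
      split_ifs with hk
      · congr 1
        ext μ
        simp only [Finset.mem_filter]
        constructor
        · rintro ⟨⟨h1, _⟩, h2⟩; exact ⟨h1, h2⟩
        · rintro ⟨h1, h2⟩
          refine ⟨⟨h1, ?_⟩, h2⟩
          rw [← hk, ← h2]; rfl
      · rw [Finset.card_eq_zero, Finset.filter_eq_empty_iff]
        intro μ hμ h2
        apply hk
        rw [← h2]
        exact (Finset.mem_filter.1 hμ).2
    · intro μ hμ
      exact Finset.mem_image_of_mem _ (hA (Finset.mem_filter.1 hμ).1)
  rw [aux N Finset.subset_union_right, aux M Finset.subset_union_left]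
  exact Finset.sum_congr rfl fun k _ => by rw [h k]

lemma exists_compressed (T : Set (X →₀ ℕ)) (hT : T.Finite) (F : Set (Finset X))
    (hF : ∀ P ∈ F, Good (keyP P) T) (M : Finset (X →₀ ℕ)) (hM : ∀ μ ∈ M, μ ∈ T)
    (hMd : DivClosed M) :
    ∃ M' : Finset (X →₀ ℕ), (∀ μ ∈ M', μ ∈ T) ∧ DivClosed M' ∧
      (∀ P ∈ F, Lower (keyP P) T M') ∧ ∀ j, FVec M' j = FVec M j := by
  obtain ⟨rk, hrk⟩ := exists_rank T hT
  let Q : Finset (X →₀ ℕ) → Prop := fun M' => (∀ μ ∈ M', μ ∈ T) ∧ DivClosed M' ∧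
      ∀ j, FVec M' j = FVec M j
  obtain ⟨A, hA⟩ := exists_minimalFor_of_wellFoundedLT Q (fun A => ∑ μ ∈ A, rk μ)
    ⟨M, hM, hMd, fun _ => rfl⟩
  refine ⟨A, hA.1.1, hA.1.2.1, fun P hP => ?_, hA.1.2.2⟩
  obtain ⟨B, hB1, hB2, hB3, hB4⟩ := exists_lower (keyP P) T rk hrk A hA.1.1
  have hQB : Q B := ⟨hB1, hF P hP A B hA.1.1 hB1 hA.1.2.1 hB2 hB3,
    fun j => (fvec_of_keyP hB2 j).trans (hA.1.2.2 j)⟩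
  apply hB4
  rcases le_total (∑ μ ∈ A, rk μ) (∑ μ ∈ B, rk μ) with h | h
  · exact h
  · exact hA.2 hQB h


lemma finite_of_deg (T : Set (X →₀ ℕ)) (d : ℕ) (h : ∀ μ ∈ T, degM μ ≤ d) : T.Finite := by
  refine (Set.finite_Iic (Finsupp.equivFunOnFinite.symm (fun _ : X => d))).subset ?_
  intro μ hμ x
  have : μ x ≤ degM μ :=
    Finset.single_le_sum (f := μ) (fun _ _ => Nat.zero_le _) (Finset.mem_univ x)
  simpa using this.trans (h μ hμ)

/-- The fiber of `A` over `ν`. -/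
def fibF (P : Finset X) (ν : X →₀ ℕ) (A : Finset (X →₀ ℕ)) : Finset (X →₀ ℕ) :=
  (A.filter (fun μ => μ.filter (fun x => x ∉ P) = ν)).image (fun μ => μ.filter (fun x => x ∈ P))

lemma filter_add_filter (P : Finset X) (μ : X →₀ ℕ) :
    μ.filter (fun x => x ∈ P) + μ.filter (fun x => x ∉ P) = μ := by
  ext x
  by_cases h : x ∈ P <;> simp [h]

lemma filter_in {P : Finset X} {π ν : X →₀ ℕ} (hν : ∀ x ∈ P, ν x = 0)
    (hπ : ∀ x, x ∉ P → π x = 0) : (π + ν).filter (fun x => x ∈ P) = π := by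
  ext x
  by_cases h : x ∈ P
  · simp [h, hν x h]
  · simp [h, hπ x h]

lemma filter_out {P : Finset X} {π ν : X →₀ ℕ} (hν : ∀ x ∈ P, ν x = 0)
    (hπ : ∀ x, x ∉ P → π x = 0) : (π + ν).filter (fun x => x ∉ P) = ν := by
  ext x
  by_cases h : x ∈ P
  · simp [h, hν x h]
  · simp [h, hπ x h]

lemma mem_fibF {P : Finset X} {ν : X →₀ ℕ} (hν : ∀ x ∈ P, ν x = 0) {A : Finset (X →₀ ℕ)}
    {π : X →₀ ℕ} : π ∈ fibF P ν A ↔ (∀ x, x ∉ P → π x = 0) ∧ π + ν ∈ A := by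
  unfold fibF
  simp only [Finset.mem_image, Finset.mem_filter]
  constructor
  · rintro ⟨μ, ⟨hμ, rfl⟩, rfl⟩
    refine ⟨fun x hx => by simp [hx], ?_⟩
    rwa [filter_add_filter]
  · rintro ⟨h1, h2⟩
    exact ⟨π + ν, ⟨h2, filter_out hν h1⟩, filter_in hν h1⟩

lemma card_fibF {P : Finset X} {ν : X →₀ ℕ} (hν : ∀ x ∈ P, ν x = 0) (A : Finset (X →₀ ℕ))
    (j : ℕ) : ((fibF P ν A).filter (fun π => degM π = j)).card =
      (A.filter (fun μ => keyP P μ = (ν, j + degM ν))).card := by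
  have : A.filter (fun μ => keyP P μ = (ν, j + degM ν)) =
      ((fibF P ν A).filter (fun π => degM π = j)).image (fun π => π + ν) := by
    ext μ
    simp only [Finset.mem_image, Finset.mem_filter, mem_fibF hν, keyP, Prod.mk.injEq]
    constructor
    · rintro ⟨h1, h2, h3⟩
      have h4 : μ.filter (fun x => x ∈ P) + ν = μ := by rw [← h2]; exact filter_add_filter P μ
      refine ⟨μ.filter (fun x => x ∈ P), ⟨⟨fun x hx => by simp [hx], by rwa [h4]⟩, ?_⟩, h4⟩
      have := degM_add (μ.filter (fun x => x ∈ P)) ν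
      rw [h4] at this
      omega
    · rintro ⟨π, ⟨⟨h1, h2⟩, h3⟩, rfl⟩
      exact ⟨h2, filter_out hν h1, by rw [degM_add, h3]⟩
  rw [this, Finset.card_image_of_injective _ (add_left_injective ν)]

lemma good_of_fiber (P : Finset X) (T : Set (X →₀ ℕ))
    (hTd : ∀ μ ∈ T, ∀ ν, ν ≤ μ → ν ∈ T)
    (hstar : ∀ σ x, x ∉ P → σ + Finsupp.single x 1 ∈ T → ∀ τ ∈ T, keyP P τ = keyP P σ →
      toLex τ < toLex σ → τ + Finsupp.single x 1 ∈ T)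
    (hfib : ∀ ν : X →₀ ℕ, (∀ x ∈ P, ν x = 0) →
      Good degM {π | (∀ x, x ∉ P → π x = 0) ∧ π + ν ∈ T}) : Good (keyP P) T := by
  intro M N hM hN hMd hcard hlow
  apply divClosed_of_step
  intro σ x hσ
  have hσT : σ ∈ T := hTd _ (hN _ hσ) _ (by simp)
  by_cases hx : x ∈ P
  · set ν := σ.filter (fun x => x ∉ P) with hνdef
    have hν : ∀ x ∈ P, ν x = 0 := fun x hx => by simp [hνdef, hx]
    have hdc : DivClosed (fibF P ν N) := by
      refine hfib ν hν (fibF P ν M) (fibF P ν N) ?_ ?_ ?_ ?_ ?_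
      · intro π hπ
        rw [mem_fibF hν] at hπ
        exact ⟨hπ.1, hM _ hπ.2⟩
      · intro π hπ
        rw [mem_fibF hν] at hπ
        exact ⟨hπ.1, hN _ hπ.2⟩
      · intro π hπ ρ hρ
        rw [mem_fibF hν] at *
        refine ⟨fun x hx => ?_, hMd _ hπ.2 _ fun x => ?_⟩
        · have := hρ x
          rw [hπ.1 x hx] at this
          omega
        · simpa using hρ x
      · intro j
        rw [card_fibF hν, card_fibF hν, hcard]
      · rintro π hπ ρ ⟨hρ1, hρ2⟩ hdeg hlt
        rw [mem_fibF hν] at *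
        refine ⟨hρ1, hlow _ hπ.2 _ hρ2 ?_ (lex_add hlt ν)⟩
        rw [keyP_eq]
        refine ⟨fun x hx => by simp [hρ1 x hx, hπ.1 x hx], by simp [degM_add, hdeg]⟩
    have hsplit := filter_add_filter P σ
    rw [← hνdef] at hsplit
    have h1 : σ.filter (fun x => x ∈ P) + Finsupp.single x 1 ∈ fibF P ν N := by
      rw [mem_fibF hν]
      constructor
      · intro y hy
        have : x ≠ y := by rintro rfl; exact hy hx
        simp [hy, Finsupp.single_apply, this]
      · convert hσ using 1
        rw [add_right_comm, hsplit]
    have h2 := hdc.step h1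
    rw [mem_fibF hν, hsplit] at h2
    exact h2.2
  · by_contra hcon
    set μ := σ + Finsupp.single x 1 with hμ
    have hkey : ∀ τ, keyP P τ = keyP P σ ↔ keyP P (τ + Finsupp.single x 1) = keyP P μ := by
      intro τ
      simp [keyP_eq, hμ, degM_add]
    have e1 : (N.filter (fun τ => keyP P τ = keyP P σ)).card <
        (N.filter (fun τ => keyP P τ = keyP P μ)).card := by
      rw [← Finset.card_image_of_injective _ (add_left_injective (Finsupp.single x 1))]
      apply Finset.card_lt_card
      rw [Finset.ssubset_iff_of_subset]
      · refine ⟨μ, by simp [hσ], ?_⟩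
        simp only [Finset.mem_image, Finset.mem_filter, not_exists, not_and]
        rintro τ ⟨h1, h2⟩ h3
        rw [hμ, add_left_inj] at h3
        exact hcon (h3 ▸ h1)
      · intro ρ hρ
        simp only [Finset.mem_image, Finset.mem_filter] at hρ
        obtain ⟨τ, ⟨h1, h2⟩, rfl⟩ := hρ
        have hlt : toLex τ < toLex σ := by
          rcases lt_trichotomy (toLex τ) (toLex σ) with h | h | h
          · exact h
          · exact absurd (toLex.injective h ▸ h1) hcon
          · exact absurd (hlow τ h1 σ hσT h2.symm h) hcon
        have h3 := hstar σ x hx (hN _ hσ) τ (hN _ h1) h2 hlt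
        rw [Finset.mem_filter]
        exact ⟨hlow μ hσ _ h3 ((hkey τ).1 h2) (lex_add hlt _), (hkey τ).1 h2⟩
    have e2 : (M.filter (fun τ => keyP P τ = keyP P μ)).card ≤
        (M.filter (fun τ => keyP P τ = keyP P σ)).card := by
      rw [← Finset.card_image_of_injective (M.filter (fun τ => keyP P τ = keyP P σ))
        (add_left_injective (Finsupp.single x 1))]
      apply Finset.card_le_card
      intro ρ hρ
      rw [Finset.mem_filter] at hρ
      have hle : Finsupp.single x 1 ≤ ρ := by
        rw [Finsupp.single_le_iff]
        have := (keyP_eq.1 hρ.2).1 x hx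
        rw [this]; simp [hμ]
      obtain ⟨τ, rfl⟩ := exists_add_of_le hle
      rw [add_comm] at hρ
      simp only [Finset.mem_image, Finset.mem_filter]
      exact ⟨τ, ⟨hMd.step hρ.1, (hkey τ).2 hρ.2⟩, add_comm _ _⟩
    rw [hcard, hcard] at e1
    omega

/-- The universe of monomials. -/
def UU (V W : Finset X) (a d : ℕ) : Set (X →₀ ℕ) :=
  {μ | (∀ x, x ∉ V → μ x = 0) ∧ degM μ ≤ d ∧ degW W μ ≤ a}

lemma UU_down {V W : Finset X} {a d : ℕ} : ∀ μ ∈ UU V W a d, ∀ ν, ν ≤ μ → ν ∈ UU V W a d := by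
  rintro μ ⟨h1, h2, h3⟩ ν hν
  refine ⟨fun x hx => ?_, (degM_mono hν).trans h2, (degW_mono W hν).trans h3⟩
  have := hν x
  rw [h1 x hx] at this
  omega


lemma lexpair {x y : X} (hyx : y < x) {τ σ : X →₀ ℕ} (hd : degM τ = degM σ)
    (h : ∀ z, z ≠ x → z ≠ y → τ z = σ z) : toLex τ < toLex σ ↔ τ y < σ y := by
  rw [lex_iff]
  constructor
  · rintro ⟨w, h1, h2⟩
    by_cases hwy : w = y
    · rwa [hwy] at h2
    by_cases hwx : w = x
    · subst hwx
      have : τ = σ := eq_of_degM w hd fun z hz => by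
        by_cases hzy : z = y
        · rw [hzy]; exact h1 y hyx
        · exact h z hz hzy
      rw [this] at h2
      omega
    · have := h w hwx hwy
      omega
  · intro h2
    exact ⟨y, fun z hz => h z (hz.trans hyx).ne hz.ne, h2⟩

lemma pairW {x y : X} (hyx : y ≠ x) {W : Finset X} (hW : x ∈ W → y ∈ W) {τ μ : X →₀ ℕ}
    (hd : degM τ = degM μ) (h : ∀ z, z ≠ x → z ≠ y → τ z = μ z) (hle : τ y ≤ μ y) :
    degW W τ ≤ degW W μ := by
  have key : τ + Finsupp.single y (μ y - τ y) = μ + Finsupp.single x (μ y - τ y) := by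
    apply eq_of_degM x
    · rw [degM_add, degM_add, degM_single, degM_single, hd]
    · intro z hz
      by_cases hzy : z = y
      · subst hzy
        simp [Finsupp.single_apply, hz.symm]
        omega
      · simp [Finsupp.single_apply, Ne.symm hzy, hz.symm, h z hz hzy]
  have := congrArg (degW W) key
  rw [degW_add, degW_add, degW_single, degW_single] at this
  by_cases hx : x ∈ W
  · rw [if_pos hx, if_pos (hW hx)] at this
    omega
  · rw [if_neg hx] at this
    omega

lemma degM_sub {ρ : X →₀ ℕ} {x : X} (h : 1 ≤ ρ x) : degM (ρ - Finsupp.single x 1) + 1 = degM ρ := by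
  have hle : Finsupp.single x 1 ≤ ρ := by rwa [Finsupp.single_le_iff]
  conv_rhs => rw [← tsub_add_cancel_of_le hle, degM_add, degM_single]

lemma pair_good {x y : X} (hyx : y < x) (W : Finset X) (hW : x ∈ W → y ∈ W) (a d : ℕ) :
    Good degM (UU {x, y} W a d) := by
  intro M N hM hN hMd hcard hlow
  have hzero : ∀ μ ∈ UU {x, y} W a d, ∀ z, z ≠ x → z ≠ y → μ z = 0 := by
    intro μ hμ z h1 h2
    exact hμ.1 z (by simp [h1, h2])
  have hdeg : ∀ μ ∈ UU {x, y} W a d, degM μ = μ x + μ y := by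
    intro μ hμ
    have : μ = Finsupp.single x (μ x) + Finsupp.single y (μ y) := by
      ext z
      by_cases h1 : z = x
      · subst h1; simp [Finsupp.single_apply, hyx.ne]
      · by_cases h2 : z = y
        · subst h2; simp [Finsupp.single_apply, hyx.ne']
        · simp [Finsupp.single_apply, hzero μ hμ z h1 h2, Ne.symm h1, Ne.symm h2]
    conv_lhs => rw [this, degM_add, degM_single, degM_single]
  have hagree : ∀ μ ∈ UU {x, y} W a d, ∀ τ ∈ UU {x, y} W a d, ∀ z, z ≠ x → z ≠ y → μ z = τ z := by
    intro μ hμ τ hτ z h1 h2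
    rw [hzero μ hμ z h1 h2, hzero τ hτ z h1 h2]
  have hinj : ∀ μ ∈ UU {x, y} W a d, ∀ τ ∈ UU {x, y} W a d, degM μ = degM τ → μ y = τ y → μ = τ := by
    intro μ hμ τ hτ h1 h2
    refine eq_of_degM x h1 fun z hz => ?_
    by_cases hzy : z = y
    · rw [hzy, h2]
    · exact hagree μ hμ τ hτ z hz hzy
  apply divClosed_of_step
  intro σ z hσ
  by_contra hcon
  set μ := σ + Finsupp.single z 1 with hμ
  have hμT := hN _ hσ
  have hσT : σ ∈ UU {x, y} W a d := UU_down _ hμT _ (by simp [hμ])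
  have hdμ : degM μ = degM σ + 1 := by simp [hμ, degM_add, degM_single]
  have hσμ : σ y ≤ μ y := by simp [hμ]
  have hσdeg := hdeg σ hσT
  have hμdeg := hdeg μ hμT
  have h1 : (N.filter (fun τ => degM τ = degM σ)).card ≤ σ y := by
    have := Finset.card_le_card_of_injOn (s := N.filter (fun τ => degM τ = degM σ))
      (t := Finset.range (σ y)) (fun τ => τ y) ?_ ?_
    · simpa using this
    · intro τ hτ
      have hτ' := Finset.mem_filter.1 hτ
      have hτT := hN _ hτ'.1
      simp only [Finset.coe_range, Set.mem_Iio]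
      rw [← lexpair hyx hτ'.2 (hagree τ hτT σ hσT)]
      rcases lt_trichotomy (toLex τ) (toLex σ) with h | h | h
      · exact h
      · exact absurd (toLex.injective h ▸ hτ'.1) hcon
      · exact absurd (hlow τ hτ'.1 σ hσT hτ'.2.symm h) hcon
    · intro τ hτ τ' hτ' h
      have hτ := Finset.mem_filter.1 hτ
      have hτ' := Finset.mem_filter.1 hτ'
      exact hinj τ (hN _ hτ.1) τ' (hN _ hτ'.1) (hτ.2.trans hτ'.2.symm) h
  have h2 : μ y + 1 ≤ (N.filter (fun τ => degM τ = degM μ)).card := by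
    have := Finset.card_le_card_of_injOn (t := N.filter (fun τ => degM τ = degM μ))
      (s := Finset.range (μ y + 1))
      (fun t => Finsupp.single x (degM μ - t) + Finsupp.single y t) ?_ ?_
    · simpa using this
    · intro t ht
      have ht : t ≤ μ y := by simpa [Nat.lt_succ_iff] using ht
      set τ := Finsupp.single x (degM μ - t) + Finsupp.single y t with hτ
      have hdτ : degM τ = degM μ := by
        rw [hτ, degM_add, degM_single, degM_single]
        omega
      have hτy : τ y = t := by simp [hτ, Finsupp.single_apply, hyx.ne']
      have hz : ∀ z, z ∉ ({x, y} : Finset X) → τ z = 0 := by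
        intro z hz
        simp only [Finset.mem_insert, Finset.mem_singleton, not_or] at hz
        simp [hτ, Finsupp.single_apply, Ne.symm hz.1, Ne.symm hz.2]
      have hz' : ∀ z, z ≠ x → z ≠ y → τ z = μ z := by
        intro z h1 h2
        rw [hzero μ hμT z h1 h2, hz z (by simp [h1, h2])]
      have hτT : τ ∈ UU {x, y} W a d :=
        ⟨hz, by rw [hdτ]; exact hμT.2.1,
          (pairW hyx.ne hW hdτ hz' (by omega)).trans hμT.2.2⟩
      have : τ ∈ N := by
        rcases ht.lt_or_eq with h | h
        · exact hlow μ hσ τ hτT hdτ ((lexpair hyx hdτ hz').2 (by omega))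
        · rw [hinj τ hτT μ hμT hdτ (by omega)]; exact hσ
      simp only [Finset.coe_filter, Set.mem_ofPred_eq]
      exact ⟨this, hdτ⟩
    · intro t _ t' _ h
      have := DFunLike.congr_fun h y
      simpa [Finsupp.single_apply, hyx.ne'] using this
  have h3 : ∀ k, k ≤ degM μ → (M.filter (fun ρ => degM ρ = degM μ ∧ ρ y ≠ k)).card ≤
      (M.filter (fun ρ => degM ρ = degM σ)).card := by
    intro k hk
    apply Finset.card_le_card_of_injOn
      (fun ρ => if ρ y < k then ρ - Finsupp.single x 1 else ρ - Finsupp.single y 1)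
    · intro ρ hρ
      obtain ⟨h1, h2, h3⟩ := Finset.mem_filter.1 hρ
      have h4 := hdeg ρ (hM _ h1)
      simp only [Finset.coe_filter, Set.mem_ofPred_eq]
      split_ifs with h
      · refine ⟨hMd ρ h1 _ fun w => by simp, ?_⟩
        have := degM_sub (ρ := ρ) (x := x) (by omega)
        omega
      · refine ⟨hMd ρ h1 _ fun w => by simp, ?_⟩
        have := degM_sub (ρ := ρ) (x := y) (by omega)
        omega
    · intro ρ hρ ρ' hρ' h
      obtain ⟨h1, h2, h3⟩ := Finset.mem_filter.1 hρ
      obtain ⟨h1', h2', h3'⟩ := Finset.mem_filter.1 hρ'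
      apply hinj ρ (hM _ h1) ρ' (hM _ h1') (h2.trans h2'.symm)
      have := DFunLike.congr_fun h y
      simp only at this
      split_ifs at this <;> simp [Finsupp.single_apply, hyx.ne'] at this <;> omega
  rw [hcard] at h1 h2
  by_cases hex : ∃ k, k ≤ degM μ ∧ ∀ ρ ∈ M, degM ρ = degM μ → ρ y ≠ k
  · obtain ⟨k, hk, hk2⟩ := hex
    have h4 := h3 k hk
    have : M.filter (fun ρ => degM ρ = degM μ ∧ ρ y ≠ k) = M.filter (fun ρ => degM ρ = degM μ) := by
      apply Finset.filter_congr
      intro ρ hρ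
      exact ⟨fun h => h.1, fun h => ⟨h, hk2 ρ hρ h⟩⟩
    rw [this] at h4
    omega
  · push Not at hex
    have h4 := h3 (degM μ) le_rfl
    have h5 : Finset.range (degM μ) ⊆
        (M.filter (fun ρ => degM ρ = degM μ ∧ ρ y ≠ degM μ)).image (fun ρ => ρ y) := by
      intro t ht
      rw [Finset.mem_range] at ht
      obtain ⟨ρ, hρ, h6, h7⟩ := hex t ht.le
      rw [Finset.mem_image]
      exact ⟨ρ, Finset.mem_filter.2 ⟨hρ, h6, by omega⟩, h7⟩
    have h6 := (Finset.card_le_card h5).trans Finset.card_image_le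
    rw [Finset.card_range] at h6
    omega

lemma good_empty {T : Set (X →₀ ℕ)} (h : ∀ μ, μ ∉ T) : Good degM T := by
  intro M N _ hN _ _ _ μ hμ
  exact absurd (hN μ hμ) (h μ)

lemma pair_good' {V W : Finset X} {x y : X} (hx : x ∈ V) (hy : y ∈ V) (hyx : y < x)
    (hW : x ∈ W → y ∈ W) (a d : ℕ) : Good (keyP {x, y}) (UU V W a d) := by
  have hoff : ∀ τ σ : X →₀ ℕ, keyP {x, y} τ = keyP {x, y} σ →
      ∀ z, z ≠ x → z ≠ y → τ z = σ z := by
    intro τ σ h z h1 h2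
    exact (keyP_eq.1 h).1 z (by simp [h1, h2])
  apply good_of_fiber
  · exact UU_down
  · intro σ z hz hμ τ hτ hk hlt
    have hd := (keyP_eq.1 hk).2
    have hag := hoff _ _ hk
    have hy' := (lexpair hyx hd hag).1 hlt
    have hle : degW W τ ≤ degW W σ := pairW hyx.ne hW hd hag hy'.le
    have h2 := hμ.2
    rw [degM_add, degW_add] at h2
    refine ⟨fun w hw => ?_, ?_, ?_⟩
    · have h3 := hμ.1 w hw
      have h4 := hag w (by rintro rfl; exact hw hx) (by rintro rfl; exact hw hy)
      simp only [Finsupp.add_apply] at h3 ⊢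
      omega
    · rw [degM_add]; omega
    · rw [degW_add]; omega
  · intro ν hν
    by_cases hνT : ν ∈ UU V W a d
    · have : {π | (∀ x_1, x_1 ∉ ({x, y} : Finset X) → π x_1 = 0) ∧ π + ν ∈ UU V W a d} =
          UU {x, y} W (a - degW W ν) (d - degM ν) := by
        ext π
        have h1 := hνT.2
        simp only [UU, Set.mem_ofPred_eq, degM_add, degW_add]
        constructor
        · rintro ⟨h2, h3, h4, h5⟩
          exact ⟨h2, by omega, by omega⟩
        · rintro ⟨h2, h3, h4⟩
          refine ⟨h2, fun w hw => ?_, by omega, by omega⟩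
          have h5 := h2 w (by
            simp only [Finset.mem_insert, Finset.mem_singleton, not_or]
            exact ⟨by rintro rfl; exact hw hx, by rintro rfl; exact hw hy⟩)
          simp [h5, hνT.1 w hw]
      rw [this]
      exact pair_good hyx W hW _ _
    · apply good_empty
      rintro π ⟨_, h⟩
      exact hνT (UU_down _ h _ (by simp))


/-- If every member of degree `e` avoiding `x` can be shifted towards `x`, then the compressed
set contains at least as many members of degree `e` avoiding `x`. -/
lemma card_zero_le {V W : Finset X} {x : X} (hmax : ∀ y ∈ V, y < x) {a d e : ℕ} (he : 1 ≤ e)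
    (hW : ∀ y ∈ insert x V, ∀ z ∈ insert x V, z < y → y ∈ W → z ∈ W)
    (hmac : Good degM (UU V W a d))
    {M N : Finset (X →₀ ℕ)} (hM : ∀ μ ∈ M, μ ∈ UU (insert x V) W a d)
    (hN : ∀ μ ∈ N, μ ∈ UU (insert x V) W a d)
    (hshift : ∀ (σ : X →₀ ℕ) (y : X), y ∈ V → σ + Finsupp.single y 1 ∈ M →
      σ + Finsupp.single x 1 ∈ M)
    (hcard : FVec N e = FVec M e)
    (hlow : Lower degM (UU (insert x V) W a d) N) :
    (M.filter (fun μ => degM μ = e ∧ μ x = 0)).card ≤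
      (N.filter (fun μ => degM μ = e ∧ μ x = 0)).card := by
  have hxV : x ∉ V := fun h => lt_irrefl _ (hmax x h)
  set A0 := M.filter (fun μ => degM μ = e ∧ μ x = 0) with hA0
  have hA0U : ∀ μ ∈ A0, μ ∈ UU V W a d := by
    intro μ hμ
    obtain ⟨h1, h2, h3⟩ := Finset.mem_filter.1 hμ
    refine ⟨fun z hz => ?_, (hM _ h1).2⟩
    by_cases hzx : z = x
    · rw [hzx, h3]
    · exact (hM _ h1).1 z (by simp [hzx, hz])
  -- the multicomplex generated by `A0`
  set M0 := A0.biUnion (fun ρ => Finset.Iic ρ) with hM0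
  have memM0 : ∀ ν, ν ∈ M0 ↔ ∃ ρ ∈ A0, ν ≤ ρ := by
    intro ν; simp [hM0]
  have hM0U : ∀ ν ∈ M0, ν ∈ UU V W a d := by
    intro ν hν
    obtain ⟨ρ, h1, h2⟩ := (memM0 ν).1 hν
    exact UU_down _ (hA0U ρ h1) _ h2
  have hM0d : DivClosed M0 := by
    intro μ hμ ν hν
    obtain ⟨ρ, h1, h2⟩ := (memM0 μ).1 hμ
    exact (memM0 ν).2 ⟨ρ, h1, le_trans (show ν ≤ μ from hν) h2⟩
  obtain ⟨rk, hrk⟩ := exists_rank (UU V W a d) (finite_of_deg _ d fun μ hμ => hμ.2.1)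
  obtain ⟨N0, hN0U, hN0c, hN0l, -⟩ := exists_lower degM (UU V W a d) rk hrk M0 hM0U
  have hN0d : DivClosed N0 := hmac M0 N0 hM0U hN0U hM0d hN0c hN0l
  have hcardtot : N0.card = M0.card := by
    have aux : ∀ A : Finset (X →₀ ℕ), (∀ μ ∈ A, μ ∈ UU V W a d) →
        A.card = ∑ j ∈ Finset.range (d + 1), (A.filter (fun μ => degM μ = j)).card := by
      intro A hA
      apply Finset.card_eq_sum_card_fiberwise
      intro μ hμ
      have := (hA μ hμ).2.1
      simp
      omega
    rw [aux N0 hN0U, aux M0 hM0U]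
    exact Finset.sum_congr rfl fun j _ => hN0c j
  -- `M0` embeds into `M_e`
  have hpush : ∀ n : ℕ, ∀ ν ∈ M0, degM ν + n = e → ν + Finsupp.single x n ∈ M := by
    intro n
    induction n with
    | zero =>
      intro ν hν hd
      obtain ⟨ρ, h1, h2⟩ := (memM0 ν).1 hν
      obtain ⟨h3, h4, h5⟩ := Finset.mem_filter.1 h1
      obtain ⟨δ, rfl⟩ := exists_add_of_le h2
      rw [degM_add] at h4
      have : δ = 0 := by
        ext z
        have : δ z ≤ degM δ :=
          Finset.single_le_sum (f := δ) (fun _ _ => Nat.zero_le _) (Finset.mem_univ z)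
        simp; omega
      simpa [this] using h3
    | succ n ih =>
      intro ν hν hd
      obtain ⟨ρ, h1, h2⟩ := (memM0 ν).1 hν
      obtain ⟨h3, h4, h5⟩ := Finset.mem_filter.1 h1
      obtain ⟨δ, hδ⟩ := exists_add_of_le h2
      have : ∃ y, δ y ≠ 0 := by
        by_contra hcon
        push Not at hcon
        have : degM δ = 0 := Finset.sum_eq_zero fun x _ => hcon x
        rw [hδ, degM_add] at h4
        omega
      obtain ⟨y, hy⟩ := this
      have hyle : ν + Finsupp.single y 1 ≤ ρ := by
        rw [hδ]
        gcongr
        rw [Finsupp.single_le_iff]; omega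
      have hyV : y ∈ V := by
        by_contra hyV
        have := (hA0U ρ h1).1 y hyV
        rw [hδ] at this
        simp at this
        omega
      have h6 := ih (ν + Finsupp.single y 1) ((memM0 _).2 ⟨ρ, h1, hyle⟩)
        (by rw [degM_add, degM_single]; omega)
      have h7 := hshift (ν + Finsupp.single x n) y hyV (by
        convert h6 using 1; abel)
      rw [add_assoc, ← Finsupp.single_add] at h7
      exact h7
  have hM0deg : ∀ ν ∈ M0, degM ν ≤ e := by
    intro ν hν
    obtain ⟨ρ, h1, h2⟩ := (memM0 ν).1 hν
    rw [← (Finset.mem_filter.1 h1).2.1]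
    exact degM_mono h2
  have hM0le : M0.card ≤ FVec M e := by
    unfold FVec
    apply Finset.card_le_card_of_injOn (fun ν => ν + Finsupp.single x (e - degM ν))
    · intro ν hν
      have h1 := hM0deg ν hν
      simp only [Finset.coe_filter, Set.mem_ofPred_eq]
      refine ⟨hpush _ ν hν (by omega), ?_⟩
      rw [degM_add, degM_single]; omega
    · intro ν hν ν' hν' h
      ext z
      have h1 := DFunLike.congr_fun h z
      by_cases hzx : z = x
      · subst hzx
        rw [(hM0U ν hν).1 z hxV, (hM0U ν' hν').1 z hxV]
      · simpa [Finsupp.single_apply, Ne.symm hzx] using h1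
  have hM0e : M0.filter (fun μ => degM μ = e) = A0 := by
    ext ν
    rw [Finset.mem_filter]
    constructor
    · rintro ⟨h1, h2⟩
      have h3 := hpush 0 ν h1 (by omega)
      rw [hA0, Finset.mem_filter]
      exact ⟨by simpa using h3, h2, (hM0U ν h1).1 x hxV⟩
    · intro h
      exact ⟨(memM0 ν).2 ⟨ν, h, le_rfl⟩, (Finset.mem_filter.1 h).2.1⟩
  by_contra hlt
  push Not at hlt
  rw [← hM0e, ← hN0c e] at hlt
  obtain ⟨μ, hμ, hμn⟩ := Finset.exists_mem_notMem_of_card_lt_card hlt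
  obtain ⟨hμ0, hμe⟩ := Finset.mem_filter.1 hμ
  have hμU := hN0U μ hμ0
  have hμx := hμU.1 x hxV
  have hμN : μ ∉ N := fun h => hμn (Finset.mem_filter.2 ⟨h, hμe, hμx⟩)
  have hμU' : μ ∈ UU (insert x V) W a d :=
    ⟨fun z hz => hμU.1 z fun h => hz (Finset.mem_insert_of_mem h), hμU.2⟩
  have hVne : V.Nonempty := by
    by_contra hV
    rw [Finset.not_nonempty_iff_eq_empty] at hV
    have : degM μ = 0 := Finset.sum_eq_zero fun z _ => hμU.1 z (by simp [hV])
    omega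
  set y := V.max' hVne with hy
  have hyV : y ∈ V := Finset.max'_mem _ _
  have hyx : y < x := hmax y hyV
  have hymax : ∀ z ∈ V, z ≤ y := fun z hz => Finset.le_max' _ _ hz
  have hmap : ∀ τ ∈ N, degM τ = e → τ.erase x ∈ N0 := by
    intro τ hτ hτe
    have hτU := hN τ hτ
    have hltτ : toLex τ < toLex μ := by
      rcases lt_trichotomy (toLex τ) (toLex μ) with h | h | h
      · exact h
      · exact absurd (toLex.injective h ▸ hτ) hμN
      · exact absurd (hlow τ hτ μ hμU' (hμe.trans hτe.symm) h) hμN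
    set ω := τ.erase x + Finsupp.single y (τ x) with hω
    have hsplit : τ.erase x + Finsupp.single x (τ x) = τ := Finsupp.erase_add_single x τ
    have hωdeg : degM ω = e := by
      have := congrArg degM hsplit
      rw [degM_add, degM_single] at this
      rw [hω, degM_add, degM_single]; omega
    have hωne : ∀ z, z ≠ x → z ≠ y → ω z = τ z := by
      intro z h1 h2
      simp [hω, Finsupp.erase_ne h1, Finsupp.single_apply, Ne.symm h2]
    have hωx : ω x = 0 := by simp [hω, Finsupp.single_apply, hyx.ne]
    have hωz : ∀ z, z ∉ V → ω z = 0 := by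
      intro z hz
      by_cases hzx : z = x
      · rw [hzx, hωx]
      · rw [hωne z hzx (by rintro rfl; exact hz hyV)]
        exact hτU.1 z (by simp [hzx, hz])
    have hωU : ω ∈ UU V W a d := by
      refine ⟨hωz, by rw [hωdeg, ← hμe]; exact hμU.2.1, ?_⟩
      by_cases hyW : y ∈ W
      · have hVW : ∀ z ∈ V, z ∈ W := by
          intro z hz
          rcases (hymax z hz).lt_or_eq with h | h
          · exact hW y (by simp [hyV]) z (by simp [hz]) h hyW
          · rw [h]; exact hyW
        have h1 := degW_eq_degM W μ fun z hz => hμU.1 z fun h => hz (hVW z h)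
        calc degW W ω ≤ degM ω := degW_le_degM W ω
          _ = degW W μ := by rw [hωdeg, h1, hμe]
          _ ≤ a := hμU.2.2
      · have h1 : degW W ω = degW W (τ.erase x) := by
          rw [hω, degW_add, degW_single, if_neg hyW, add_zero]
        have h2 := congrArg (degW W) hsplit
        rw [degW_add] at h2
        have := hτU.2.2
        omega
    have hωN : ω ∈ N0 := by
      obtain ⟨z, hz1, hz2⟩ := (lex_iff _ _).1 hltτ
      have hzV : z ∈ V := by
        by_contra h
        rw [hμU.1 z h] at hz2
        omega
      rcases (hymax z hzV).lt_or_eq with h | h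
      · apply hN0l μ hμ0 ω hωU (hωdeg.trans hμe.symm)
        rw [lex_iff]
        refine ⟨z, fun w hw => ?_, ?_⟩
        · rw [hωne w ((hw.trans h).trans hyx).ne (hw.trans h).ne]
          exact hz1 w hw
        · rw [hωne z (h.trans hyx).ne h.ne]
          exact hz2
      · have : ω = μ := by
          apply eq_of_degM y (hωdeg.trans hμe.symm)
          intro w hw
          by_cases hwV : w ∈ V
          · rw [hωne w (hmax w hwV).ne hw]
            exact hz1 w (h ▸ lt_of_le_of_ne (hymax w hwV) hw)
          · rw [hωz w hwV, hμU.1 w hwV]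
        rw [this]; exact hμ0
    exact hN0d.step hωN
  have hfin : FVec N e < N0.card := by
    unfold FVec
    have hinj : Set.InjOn (fun τ : X →₀ ℕ => τ.erase x) (N.filter (fun μ => degM μ = e)) := by
      intro τ hτ τ' hτ' h
      have hτ := Finset.mem_filter.1 hτ
      have hτ' := Finset.mem_filter.1 hτ'
      apply eq_of_degM x (hτ.2.trans hτ'.2.symm)
      intro z hz
      have := DFunLike.congr_fun h z
      simpa [Finsupp.erase_ne hz] using this
    rw [← Finset.card_image_of_injOn hinj]
    apply Finset.card_lt_card
    rw [Finset.ssubset_iff_of_subset]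
    · refine ⟨μ, hμ0, ?_⟩
      rw [Finset.mem_image]
      rintro ⟨τ, hτ, h⟩
      have hτ := Finset.mem_filter.1 hτ
      have : τ = μ := by
        apply eq_of_degM x (hτ.2.trans hμe.symm)
        intro z hz
        rw [← h, Finsupp.erase_ne hz]
      exact hμN (this ▸ hτ.1)
    · intro ρ hρ
      obtain ⟨τ, hτ, rfl⟩ := Finset.mem_image.1 hρ
      have hτ := Finset.mem_filter.1 hτ
      exact hmap τ hτ.1 hτ.2
  omega

/-- The Macaulay theorem for monomials with a bounded partial degree. -/
lemma mac (V : Finset X) : ∀ (W : Finset X) (a d : ℕ),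
    (∀ y ∈ V, ∀ z ∈ V, z < y → y ∈ W → z ∈ W) → Good degM (UU V W a d) := by
  induction V using Finset.induction_on_max with
  | empty =>
    intro W a d _ M N _ hN _ _ _
    apply divClosed_of_step
    intro σ x hσ
    have := (hN _ hσ).1 x (by simp)
    simp at this
  | insert x V hmax ih =>
    intro W a d hW M₁ N hM₁ hN hM₁d hcard₁ hlow
    have hxV : x ∉ V := fun h => lt_irrefl _ (hmax x h)
    have hmac := ih W a d fun y hy z hz => hW y (by simp [hy]) z (by simp [hz])
    obtain ⟨M, hM, hMd, hMc, hMF⟩ := exists_compressed (UU (insert x V) W a d)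
      (finite_of_deg _ d fun μ hμ => hμ.2.1) {P | ∃ y ∈ V, P = {x, y}}
      (by
        rintro P ⟨y, hy, rfl⟩
        exact pair_good' (by simp) (by simp [hy]) (hmax y hy)
          (hW x (by simp) y (by simp [hy]) (hmax y hy)) a d) M₁ hM₁ hM₁d
    have hcard : ∀ j, FVec N j = FVec M j := fun j => (hcard₁ j).trans (hMF j).symm
    have hshift : ∀ (σ : X →₀ ℕ) (y : X), y ∈ V → σ + Finsupp.single y 1 ∈ M →
        σ + Finsupp.single x 1 ∈ M := by
      intro σ y hy h
      have hyx := hmax y hy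
      have hag : ∀ z, z ≠ x → z ≠ y → (σ + Finsupp.single x 1 : X →₀ ℕ) z = (σ + Finsupp.single y 1 : X →₀ ℕ) z := by
        intro z h1 h2
        simp [Finsupp.single_apply, Ne.symm h1, Ne.symm h2]
      have hdd : degM (σ + Finsupp.single x 1) = degM (σ + Finsupp.single y 1) := by
        simp [degM_add, degM_single]
      have hyy : (σ + Finsupp.single x 1 : X →₀ ℕ) y < (σ + Finsupp.single y 1 : X →₀ ℕ) y := by
        simp [Finsupp.single_apply, hyx.ne']
      have hU := hM _ h
      refine hMc {x, y} ⟨y, hy, rfl⟩ _ h _ ⟨fun z hz => ?_, ?_, ?_⟩ ?_ ?_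
      · rw [hag z (by rintro rfl; simp at hz) (by rintro rfl; simp [hy] at hz)]
        exact hU.1 z hz
      · rw [hdd]; exact hU.2.1
      · exact (pairW hyx.ne (hW x (by simp) y (by simp [hy]) hyx) hdd hag hyy.le).trans hU.2.2
      · rw [keyP_eq]
        refine ⟨fun z hz => ?_, hdd⟩
        simp only [Finset.mem_insert, Finset.mem_singleton, not_or] at hz
        exact hag z hz.1 hz.2
      · exact (lexpair hyx hdd hag).2 hyy
    apply divClosed_of_step
    intro σ z hσ
    by_contra hcon
    set μ := σ + Finsupp.single z 1 with hμ
    have hμU := hN _ hσ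
    have hσU : σ ∈ UU (insert x V) W a d := UU_down _ hμU _ (by simp [hμ])
    have hdμ : degM μ = degM σ + 1 := by simp [hμ, degM_add, degM_single]
    have hzx : z ≤ x := by
      have hz : z ∈ insert x V := by
        by_contra h
        have := hμU.1 z h
        simp [hμ] at this
      rcases Finset.mem_insert.1 hz with h | h
      · exact h.le
      · exact (hmax z h).le
    have hA0 := card_zero_le hmax (a := a) (d := d) (e := degM μ) (by omega) hW hmac hM hN hshift
      (hcard _) hlow
    -- multiplication by `x` stays inside `N`
    have hmul : ∀ τ ∈ UU (insert x V) W a d, degM τ = degM σ → toLex τ ≤ toLex σ →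
        τ + Finsupp.single x 1 ∈ N := by
      intro τ hτ hdτ hle
      have hd' : degM (τ + Finsupp.single x 1) = degM μ := by
        rw [degM_add, degM_single, hdτ, hdμ]
      have hzero : ∀ w, w ∉ insert x V → (τ + Finsupp.single x 1 : X →₀ ℕ) w = 0 := by
        intro w hw
        have : x ≠ w := by rintro rfl; simp at hw
        simp [hτ.1 w hw, Finsupp.single_apply, this]
      have hU : τ + Finsupp.single x 1 ∈ UU (insert x V) W a d := by
        refine ⟨hzero, by rw [hd']; exact hμU.2.1, ?_⟩
        by_cases hxW : x ∈ W
        · have hVW : ∀ w ∈ insert x V, w ∈ W := by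
            intro w hw
            rcases Finset.mem_insert.1 hw with h | h
            · rw [h]; exact hxW
            · exact hW x (by simp) w hw (hmax w h) hxW
          have h1 := degW_eq_degM W μ fun w hw => hμU.1 w fun h => hw (hVW w h)
          calc _ ≤ degM (τ + Finsupp.single x 1) := degW_le_degM W _
            _ = degW W μ := by rw [hd', h1]
            _ ≤ a := hμU.2.2
        · rw [degW_add, degW_single, if_neg hxW]
          exact hτ.2.2
      have hle2 : toLex (τ + Finsupp.single x 1) ≤ toLex μ := by
        have h1 : toLex (τ + Finsupp.single x 1) ≤ toLex (σ + Finsupp.single x 1) := by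
          rcases hle.lt_or_eq with h | h
          · exact (lex_add h _).le
          · rw [toLex.injective h]
        refine h1.trans ?_
        rcases hzx.lt_or_eq with h | h
        · rw [hμ, add_comm σ, add_comm σ]
          exact (lex_add (Finsupp.Lex.single_lt_iff.2 h) _).le
        · rw [hμ, h]
      rcases hle2.lt_or_eq with h | h
      · exact hlow μ hσ _ hU hd' h
      · rw [toLex.injective h]; exact hσ
    have e1 : (N.filter (fun τ => degM τ = degM σ)).card <
        (N.filter (fun τ => degM τ = degM μ ∧ τ x ≠ 0)).card := by
      rw [← Finset.card_image_of_injective _ (add_left_injective (Finsupp.single x 1))]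
      apply Finset.card_lt_card
      rw [Finset.ssubset_iff_of_subset]
      · refine ⟨σ + Finsupp.single x 1, ?_, ?_⟩
        · rw [Finset.mem_filter]
          exact ⟨hmul σ hσU rfl le_rfl, by rw [degM_add, degM_single, hdμ], by simp⟩
        · simp only [Finset.mem_image, Finset.mem_filter, not_exists, not_and]
          rintro τ ⟨h1, h2⟩ h3
          rw [add_left_inj] at h3
          exact hcon (h3 ▸ h1)
      · intro ρ hρ
        obtain ⟨τ, hτ, rfl⟩ := Finset.mem_image.1 hρ
        obtain ⟨h1, h2⟩ := Finset.mem_filter.1 hτ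
        rw [Finset.mem_filter]
        refine ⟨hmul τ (hN _ h1) h2 ?_, by rw [degM_add, degM_single, hdμ, h2], by simp⟩
        by_contra h
        exact hcon (hlow τ h1 σ hσU h2.symm (not_le.1 h))
    have e2 : (M.filter (fun τ => degM τ = degM μ ∧ τ x ≠ 0)).card ≤
        (M.filter (fun τ => degM τ = degM σ)).card := by
      rw [← Finset.card_image_of_injective (M.filter (fun τ => degM τ = degM σ))
        (add_left_injective (Finsupp.single x 1))]
      apply Finset.card_le_card
      intro ρ hρ
      obtain ⟨h1, h2, h3⟩ := Finset.mem_filter.1 hρ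
      have hle : Finsupp.single x 1 ≤ ρ := by
        rw [Finsupp.single_le_iff]; omega
      obtain ⟨τ, rfl⟩ := exists_add_of_le hle
      rw [add_comm] at h1 h2
      rw [degM_add, degM_single] at h2
      rw [Finset.mem_image]
      exact ⟨τ, Finset.mem_filter.2 ⟨hMd.step h1, by omega⟩, add_comm _ _⟩
    have split : ∀ A : Finset (X →₀ ℕ), (A.filter (fun τ => degM τ = degM μ ∧ τ x = 0)).card +
        (A.filter (fun τ => degM τ = degM μ ∧ τ x ≠ 0)).card = FVec A (degM μ) := by
      intro A
      unfold FVec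
      rw [← Finset.card_filter_add_card_filter_not (s := A.filter (fun τ => degM τ = degM μ))
        (fun τ => τ x = 0), Finset.filter_filter, Finset.filter_filter]
    have s1 := split M
    have s2 := split N
    have s3 := hcard (degM μ)
    have s4 : (N.filter (fun τ => degM τ = degM σ)).card =
      (M.filter (fun τ => degM τ = degM σ)).card := hcard (degM σ)
    omega

/-- Every multicomplex `M ⊆ S_d(X,(∞,a))` has a `(0)`-compressed companion multicomplex
`M' ⊆ S_d(X,(∞,a))` with the same F-vector. -/
theorem stmt6 (c : X → ℕ) (a : ℕ → ℕ) (m d : ℕ)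
    (hm : ∀ x, c x ≤ m) (horder : ∀ x y : X, c x < c y → y < x)
    (ha : ∀ i, 1 ≤ i → i ≤ m → 0 < a i) (hd : 1 ≤ d)
    (M : Finset (X →₀ ℕ)) (hMS : ∀ μ ∈ M, InS c a m d μ) (hMdc : DivClosed M) :
    ∃ M' : Finset (X →₀ ℕ), (∀ μ ∈ M', InS c a m d μ) ∧ DivClosed M' ∧
      (∀ i, 1 ≤ i → i ≤ m → Compressed0i c a m d i M') ∧
      ∀ j, FVec M' j = FVec M j := by
  
  let T : Set (X →₀ ℕ) := {μ | InS c a m d μ}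
  have hTd : ∀ μ ∈ T, ∀ ν, ν ≤ μ → ν ∈ T := by
    rintro μ ⟨h1, h2⟩ ν hν
    exact ⟨(degM_mono hν).trans h1, fun i hi hi' => (degW_mono _ hν).trans (h2 i hi hi')⟩
  let V : ℕ → Finset X := fun i => Finset.univ.filter (fun x => c x = 0 ∨ c x = i)
  have hV : ∀ i x, x ∈ V i ↔ c x = 0 ∨ c x = i := fun i x => by simp [V]
  have hcadd : ∀ i (μ ν : X →₀ ℕ), degC c i (μ + ν) = degC c i μ + degC c i ν :=
    fun i μ ν => degW_add _ μ ν
  have hczero : ∀ i (μ : X →₀ ℕ), (∀ x, c x = i → μ x = 0) → degC c i μ = 0 := by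
    intro i μ h
    exact Finset.sum_eq_zero fun x hx => h x (Finset.mem_filter.1 hx).2
  have hccongr : ∀ i (μ ν : X →₀ ℕ), (∀ x, c x = i → μ x = ν x) → degC c i μ = degC c i ν := by
    intro i μ ν h
    exact Finset.sum_congr rfl fun x hx => h x (Finset.mem_filter.1 hx).2
  obtain ⟨M', hM', hd', hc', hf'⟩ := exists_compressed T (finite_of_deg _ d fun μ hμ => hμ.1)
    {P | ∃ i, 1 ≤ i ∧ i ≤ m ∧ P = V i} (by
      rintro P ⟨i, hi, him, rfl⟩
      apply good_of_fiber _ _ hTd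
      · intro σ x hx hμ τ hτ hk hlt
        have hk' := keyP_eq.1 hk
        refine ⟨?_, fun k hk1 hkm => ?_⟩
        · have := hμ.1
          rw [degM_add] at this ⊢
          omega
        · by_cases hki : k = i
          · subst hki
            have h0 : degC c k (Finsupp.single x 1) = 0 := by
              apply hczero
              intro y hy
              have : x ≠ y := by
                rintro rfl
                exact hx ((hV k x).2 (Or.inr hy))
              simp [Finsupp.single_apply, this]
            rw [hcadd, h0]
            exact hτ.2 k hk1 hkm
          · rw [hcadd, hccongr k τ σ, ← hcadd]
            · exact hμ.2 k hk1 hkm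
            · intro y hy
              apply hk'.1
              rw [hV]
              omega
      · intro ν hν
        by_cases hνT : ν ∈ T
        · have : {π : X →₀ ℕ | (∀ x, x ∉ V i → π x = 0) ∧ π + ν ∈ T} =
              UU (V i) (Finset.univ.filter (fun x => c x = i)) (a i) (d - degM ν) := by
            ext π
            have hν1 := hνT.1
            have hνi : degC c i ν = 0 := hczero i ν fun x hx => hν x ((hV i x).2 (Or.inr hx))
            constructor
            · rintro ⟨h1, h2, h3⟩
              rw [degM_add] at h2
              refine ⟨h1, by omega, ?_⟩
              have := h3 i hi him
              rw [hcadd, hνi] at this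
              exact this
            · rintro ⟨h1, h2, h3⟩
              refine ⟨h1, by rw [degM_add]; omega, fun k hk1 hkm => ?_⟩
              rw [hcadd]
              by_cases hki : k = i
              · subst hki
                rw [hνi]
                exact h3
              · have : degC c k π = 0 := hczero k π fun x hx => h1 x (by rw [hV]; omega)
                rw [this, zero_add]
                exact hνT.2 k hk1 hkm
          rw [this]
          apply mac
          intro y hy z hz hzy hyW
          have h1 := (hV i z).1 hz
          simp only [Finset.mem_filter, Finset.mem_univ, true_and] at hyW ⊢
          rcases h1 with h | h
          · exact absurd (horder z y (by omega)) (not_lt.2 hzy.le)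
          · exact h
        · apply good_empty
          rintro π ⟨_, h⟩
          exact hνT (hTd _ h _ (by simp))) M hMS hMdc
  refine ⟨M', hM', hd', ?_, hf'⟩
  intro i hi him μ hμ μ' hμ' hdeg hag hlt
  refine hc' (V i) ⟨i, hi, him, rfl⟩ μ hμ μ' hμ' ?_ ?_
  · rw [keyP_eq]
    refine ⟨fun x hx => ?_, hdeg⟩
    rw [hV, not_or] at hx
    exact hag x hx.1 hx.2
  · obtain ⟨x, hx1, hx2, hx3⟩ := hlt
    rw [lex_iff]
    refine ⟨x, fun y hy => ?_, hx2⟩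
    by_cases h : c y = 0 ∨ c y = i
    · exact hx3 y h hy
    · rw [not_or] at h
      exact hag y h.1 h.2
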